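/- arXiv:2202.09015 — 3 statements merged into one kernel-verified Lean document; each statement's English description precedes it below -/
import Mathlib

section
/- Let α ∈ (1,2) and let g : (0,1] → [0,∞) be continuous with ∫₀¹ s^(α-1) g(s) ds < ∞. Define u(t) = ∫₀¹ G(t,s) g(s) ds with G the fractional Green's function of order α. Then u' exists on (0,1) and ∫₀¹ |u'(t)| dt ≤ 2 ∫₀¹ s^(α-1)(1-s)^(α-1) g(s)/Γ(α) ds < ∞; consequently u is absolutely continuous on [0,1]. -/
open MeasureTheory Set

/-- The Green's function of the fractional Dirichlet problem. -/
noncomputable def fracGreen (α t s : ℝ) : ℝ :=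
  if s ≤ t then ((t * (1 - s)) ^ (α - 1) - (t - s) ^ (α - 1)) / Real.Gamma α
  else (t * (1 - s)) ^ (α - 1) / Real.Gamma α

/-- The power `r ^ β` on the positive half-line, extended by zero. -/
noncomputable def posPow (β r : ℝ) : ℝ := if 0 < r then r ^ β else 0

lemma measurable_posPow (β : ℝ) : Measurable (posPow β) :=
  Measurable.ite measurableSet_Ioi (measurable_id.pow_const β) measurable_const

lemma posPow_nonneg (β r : ℝ) : 0 ≤ posPow β r := by
  unfold posPow
  split_ifs with h
  · positivity
  · rfl

lemma intervalIntegrable_posPow {β : ℝ} (hβ : -1 < β) (a b : ℝ) :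
    IntervalIntegrable (posPow β) volume a b := by
  have h : IntervalIntegrable (fun r : ℝ => r ^ β) volume a b :=
    intervalIntegral.intervalIntegrable_rpow' hβ
  have e : posPow β = (Ioi (0:ℝ)).indicator (fun r => r ^ β) := by
    ext r
    simp [posPow, indicator]
  rw [e]
  exact ⟨h.1.indicator measurableSet_Ioi, h.2.indicator measurableSet_Ioi⟩

lemma integral_posPow {β : ℝ} (hβ : -1 < β) {a : ℝ} (ha : a ≤ 0) (b : ℝ) :
    ∫ r in a..b, posPow β r = posPow (β + 1) b / (β + 1) := by
  have hz : ∀ c ≤ 0, ∫ r in a..c, posPow β r = 0 := by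
    intro c hc
    refine (intervalIntegral.integral_congr (g := fun _ => 0) fun r hr => ?_).trans (by simp)
    have : r ≤ 0 := hr.2.trans (max_le ha hc)
    simp [posPow, this.not_gt]
  rcases le_or_gt b 0 with hb | hb
  · rw [hz b hb]
    simp [posPow, hb.not_gt]
  · rw [← intervalIntegral.integral_add_adjacent_intervals (intervalIntegrable_posPow hβ a 0)
      (intervalIntegrable_posPow hβ 0 b), hz 0 le_rfl, zero_add]
    have : ∫ r in (0:ℝ)..b, posPow β r = ∫ r in (0:ℝ)..b, r ^ β := by
      rw [intervalIntegral.integral_of_le hb.le, intervalIntegral.integral_of_le hb.le]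
      refine setIntegral_congr_fun measurableSet_Ioc fun r hr => ?_
      simp [posPow, hr.1]
    rw [this, integral_rpow (Or.inl hβ), Real.zero_rpow (by linarith)]
    simp [posPow, hb]

/-- The partial derivative in `t` of the Green's function `fracGreen α t s`. -/
noncomputable def fracGreenDeriv (α t s : ℝ) : ℝ :=
  (α - 1) / Real.Gamma α * (posPow (α - 2) t * (1 - s) ^ (α - 1) - posPow (α - 2) (t - s))

lemma measurable_fracGreenDeriv (α : ℝ) :
    Measurable (fun z : ℝ × ℝ => fracGreenDeriv α z.1 z.2) := by
  have h1 : Measurable (fun z : ℝ × ℝ => posPow (α - 2) z.1) :=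
    (measurable_posPow _).comp measurable_fst
  have h2 : Measurable (fun z : ℝ × ℝ => posPow (α - 2) (z.1 - z.2)) :=
    (measurable_posPow _).comp (measurable_fst.sub measurable_snd)
  exact ((h1.mul ((measurable_const.sub measurable_snd).pow_const _)).sub h2).const_mul _

lemma intervalIntegrable_fracGreenDeriv {α : ℝ} (hα : 1 < α) (s a b : ℝ) :
    IntervalIntegrable (fun t => fracGreenDeriv α t s) volume a b := by
  have h : ∀ c d, IntervalIntegrable (posPow (α - 2)) volume c d :=
    intervalIntegrable_posPow (by linarith)
  have h2 := (h (a - s) (b - s)).comp_sub_right s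
  simp only [sub_add_cancel] at h2
  exact (((h a b).mul_const _).sub h2).const_mul _

lemma integral_fracGreenDeriv {α : ℝ} (hα : 1 < α) {s : ℝ} (hs : s ∈ Ioc (0:ℝ) 1) {x : ℝ}
    (hx : 0 ≤ x) : ∫ t in (0:ℝ)..x, fracGreenDeriv α t s = fracGreen α x s := by
  have h : ∀ c d, IntervalIntegrable (posPow (α - 2)) volume c d :=
    intervalIntegrable_posPow (by linarith)
  have h2 := (h (0 - s) (x - s)).comp_sub_right s
  simp only [sub_add_cancel] at h2
  have hα' : α - 2 + 1 = α - 1 := by ring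
  have hne : α - 1 ≠ 0 := by linarith
  have hΓ : Real.Gamma α ≠ 0 := (Real.Gamma_pos_of_pos (by linarith)).ne'
  have hp : posPow (α - 1) x = x ^ (α - 1) := by
    rcases hx.eq_or_lt with rfl | h
    · simp [posPow, Real.zero_rpow hne]
    · simp [posPow, h]
  simp only [fracGreenDeriv]
  rw [intervalIntegral.integral_const_mul, intervalIntegral.integral_sub ((h 0 x).mul_const _) h2,
    intervalIntegral.integral_mul_const, intervalIntegral.integral_comp_sub_right,
    integral_posPow (by linarith) le_rfl, integral_posPow (by linarith) (by linarith [hs.1]),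
    hα', hp, fracGreen, Real.mul_rpow hx (by linarith [hs.2])]
  rcases lt_trichotomy s x with hlt | rfl | hlt
  · rw [if_pos hlt.le, posPow, if_pos (by linarith)]
    field_simp
  · rw [if_pos le_rfl, posPow, if_neg (by linarith), sub_self, Real.zero_rpow hne]
    field_simp
  · rw [if_neg hlt.not_ge, posPow, if_neg (by linarith)]
    field_simp
    simp

lemma abs_fracGreenDeriv_of_le {α : ℝ} (hα : 1 < α) {s t : ℝ} (hs : s ∈ Ioc (0:ℝ) 1)
    (hts : t ≤ s) : |fracGreenDeriv α t s| = fracGreenDeriv α t s := by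
  have hΓ := Real.Gamma_pos_of_pos (show 0 < α by linarith)
  refine abs_of_nonneg (mul_nonneg (div_nonneg (by linarith) hΓ.le) ?_)
  have : posPow (α - 2) (t - s) = 0 := if_neg (by linarith)
  rw [this, sub_zero]
  exact mul_nonneg (posPow_nonneg _ _) (Real.rpow_nonneg (by linarith [hs.2]) _)

lemma abs_fracGreenDeriv_of_lt {α : ℝ} (hα1 : 1 < α) (hα2 : α < 2) {s t : ℝ}
    (hs : s ∈ Ioc (0:ℝ) 1) (hst : s < t) (ht : t ≤ 1) :
    |fracGreenDeriv α t s| = -fracGreenDeriv α t s := by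
  have hΓ := Real.Gamma_pos_of_pos (show 0 < α by linarith)
  refine abs_of_nonpos (mul_nonpos_of_nonneg_of_nonpos (div_nonneg (by linarith) hΓ.le) ?_)
  have ht0 : 0 < t := hs.1.trans hst
  have h1s : 0 < 1 - s := by linarith
  simp only [posPow, if_pos ht0, if_pos (sub_pos.2 hst)]
  have h1 : (t * (1 - s)) ^ (α - 2) ≤ (t - s) ^ (α - 2) :=
    Real.rpow_le_rpow_of_nonpos (by linarith) (by nlinarith [hs.1]) (by linarith)
  have h2 : (1 - s) ^ (α - 1) ≤ (1 - s) ^ (α - 2) :=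
    Real.rpow_le_rpow_of_exponent_ge h1s (by linarith [hs.1]) (by linarith)
  rw [Real.mul_rpow ht0.le h1s.le] at h1
  have := mul_le_mul_of_nonneg_left h2 (Real.rpow_nonneg ht0.le (α - 2))
  linarith

lemma integral_abs_fracGreenDeriv {α : ℝ} (hα1 : 1 < α) (hα2 : α < 2) {s : ℝ}
    (hs : s ∈ Ioc (0:ℝ) 1) : ∫ t in (0:ℝ)..1, |fracGreenDeriv α t s| =
      2 * (s ^ (α - 1) * (1 - s) ^ (α - 1) / Real.Gamma α) := by
  have hI := intervalIntegrable_fracGreenDeriv hα1 s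
  have h1 : ∫ t in (0:ℝ)..s, |fracGreenDeriv α t s| = ∫ t in (0:ℝ)..s, fracGreenDeriv α t s := by
    rw [intervalIntegral.integral_of_le hs.1.le, intervalIntegral.integral_of_le hs.1.le]
    exact setIntegral_congr_fun measurableSet_Ioc fun t ht => abs_fracGreenDeriv_of_le hα1 hs ht.2
  have h2 : ∫ t in s..(1:ℝ), |fracGreenDeriv α t s| = -∫ t in s..(1:ℝ), fracGreenDeriv α t s := by
    rw [← intervalIntegral.integral_neg, intervalIntegral.integral_of_le hs.2,
      intervalIntegral.integral_of_le hs.2]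
    exact setIntegral_congr_fun measurableSet_Ioc fun t ht =>
      abs_fracGreenDeriv_of_lt hα1 hα2 hs ht.1 ht.2
  have h3 := intervalIntegral.integral_add_adjacent_intervals (hI 0 s) (hI s 1)
  rw [integral_fracGreenDeriv hα1 hs hs.1.le, integral_fracGreenDeriv hα1 hs zero_le_one] at h3
  have h4 : fracGreen α 1 s = 0 := by simp [fracGreen, hs.2]
  have h5 : fracGreen α s s = s ^ (α - 1) * (1 - s) ^ (α - 1) / Real.Gamma α := by
    simp [fracGreen, Real.zero_rpow (show α - 1 ≠ 0 by linarith),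
      Real.mul_rpow hs.1.le (show 0 ≤ 1 - s by linarith [hs.2])]
  rw [← intervalIntegral.integral_add_adjacent_intervals (hI 0 s).abs (hI s 1).abs, h1, h2,
    integral_fracGreenDeriv hα1 hs hs.1.le]
  linarith

lemma integrable_fracGreenDeriv_mul {α : ℝ} (hα1 : 1 < α) (hα2 : α < 2) {g : ℝ → ℝ}
    (hc : ContinuousOn g (Ioc 0 1)) (hH : IntegrableOn (fun s => s ^ (α - 1) * g s) (Ioc 0 1)) :
    Integrable (fun z : ℝ × ℝ => fracGreenDeriv α z.1 z.2 * g z.2)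
      ((volume.restrict (Ioc (0:ℝ) 1)).prod (volume.restrict (Ioc (0:ℝ) 1))) := by
  have hg : AEStronglyMeasurable g (volume.restrict (Ioc (0:ℝ) 1)) :=
    hc.aestronglyMeasurable measurableSet_Ioc
  have hm : AEStronglyMeasurable (fun z : ℝ × ℝ => fracGreenDeriv α z.1 z.2 * g z.2)
      ((volume.restrict (Ioc (0:ℝ) 1)).prod (volume.restrict (Ioc (0:ℝ) 1))) :=
    (measurable_fracGreenDeriv α).aestronglyMeasurable.mul hg.comp_snd
  refine (integrable_prod_iff' hm).2 ⟨.of_forall fun s => ?_, ?_⟩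
  · exact (intervalIntegrable_fracGreenDeriv hα1 s 0 1).1.mul_const (g s)
  · have hΓ := Real.Gamma_pos_of_pos (show 0 < α by linarith)
    have hb : IntegrableOn (fun s => (2 * (1 - s) ^ (α - 1) / Real.Gamma α) *
        ‖s ^ (α - 1) * g s‖) (Ioc 0 1) := by
      refine hH.norm.bdd_mul (c := 2 / Real.Gamma α) ?_ ?_
      · exact ((((measurable_const.sub measurable_id).pow_const _).const_mul _).div_const
          _).aestronglyMeasurable
      · filter_upwards [ae_restrict_mem measurableSet_Ioc] with s hs
        have h0 : 0 ≤ (1 - s) ^ (α - 1) := Real.rpow_nonneg (by linarith [hs.2]) _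
        have h1 : (1 - s) ^ (α - 1) ≤ 1 :=
          Real.rpow_le_one (by linarith [hs.2]) (by linarith [hs.1]) (by linarith)
        rw [Real.norm_of_nonneg (by positivity)]
        gcongr
        linarith
    refine hb.congr_fun (fun s hs => ?_) measurableSet_Ioc
    have h0 : 0 ≤ s ^ (α - 1) := Real.rpow_nonneg hs.1.le _
    simp only [norm_mul, Real.norm_eq_abs, abs_of_nonneg h0]
    rw [integral_mul_const, ← intervalIntegral.integral_of_le zero_le_one,
      integral_abs_fracGreenDeriv hα1 hα2 hs]
    ring

/-- Close to `s = 0` the derivative of the Green's function is `O(s)`, locally uniformly in `t`. -/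
lemma abs_fracGreenDeriv_le {α δ s t : ℝ} (hα1 : 1 < α) (hα2 : α < 2) (hs : 0 < s) (hsδ : s ≤ δ)
    (hδt : 2 * δ < t) (ht : t ≤ 1) : |fracGreenDeriv α t s| ≤
      (α - 1) / Real.Gamma α * (δ ^ (α - 2) * (1 + 1 / δ)) * s ^ (α - 1) := by
  have hΓ := Real.Gamma_pos_of_pos (show 0 < α by linarith)
  have hδ : 0 < δ := hs.trans_le hsδ
  have ht0 : 0 < t := by linarith
  have hst : s < t := by linarith
  rw [abs_fracGreenDeriv_of_lt hα1 hα2 ⟨hs, by linarith⟩ hst ht, fracGreenDeriv, ← mul_neg,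
    mul_assoc]
  refine mul_le_mul_of_nonneg_left ?_ (div_nonneg (by linarith) hΓ.le)
  simp only [posPow, if_pos ht0, if_pos (sub_pos.2 hst)]
  have e : t - s = t * (1 - s / t) := by field_simp
  have hx : s / t ≤ 1 / 2 := by rw [div_le_div_iff₀ ht0 two_pos]; linarith
  have hx0 : 0 < s / t := div_pos hs ht0
  have h1 : (1 - s / t) ^ (α - 2) ≤ 1 + 2 * (s / t) := by
    calc (1 - s / t) ^ (α - 2) ≤ (1 - s / t) ^ (-1 : ℝ) :=
          Real.rpow_le_rpow_of_exponent_ge (by linarith) (by linarith) (by linarith)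
      _ ≤ _ := by
          rw [Real.rpow_neg_one, inv_le_iff_one_le_mul₀ (by linarith)]
          nlinarith
  have h2 : 1 - s ≤ (1 - s) ^ (α - 1) := by
    calc 1 - s = (1 - s) ^ (1 : ℝ) := (Real.rpow_one _).symm
      _ ≤ _ := Real.rpow_le_rpow_of_exponent_ge (by linarith) (by linarith) (by linarith)
  have h3 : s ≤ s ^ (α - 1) := by
    calc s = s ^ (1 : ℝ) := (Real.rpow_one _).symm
      _ ≤ _ := Real.rpow_le_rpow_of_exponent_ge hs (by linarith) (by linarith)
  have h4 : t ^ (α - 2) ≤ δ ^ (α - 2) :=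
    Real.rpow_le_rpow_of_nonpos hδ (by linarith) (by linarith)
  have h5 : s / t ≤ s / (2 * δ) := by gcongr
  have h6 : 0 < t ^ (α - 2) := Real.rpow_pos_of_pos ht0 _
  rw [e, Real.mul_rpow ht0.le (by linarith)]
  calc -(t ^ (α - 2) * (1 - s) ^ (α - 1) - t ^ (α - 2) * (1 - s / t) ^ (α - 2))
      = t ^ (α - 2) * ((1 - s / t) ^ (α - 2) - (1 - s) ^ (α - 1)) := by ring
    _ ≤ t ^ (α - 2) * (s + 2 * (s / (2 * δ))) := by gcongr; linarith
    _ = t ^ (α - 2) * ((1 + 1 / δ) * s) := by field_simp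
    _ ≤ δ ^ (α - 2) * ((1 + 1 / δ) * s ^ (α - 1)) := by gcongr
    _ = _ := by ring

lemma continuousAt_posPow {β r : ℝ} (hr : r ≠ 0) : ContinuousAt (posPow β) r := by
  rcases hr.lt_or_gt with h | h
  · refine (continuousAt_const (y := (0:ℝ))).congr ?_
    filter_upwards [Iio_mem_nhds h] with x hx
    exact (if_neg (not_lt.2 (le_of_lt hx))).symm
  · refine (Real.continuousAt_rpow_const r β (Or.inl hr)).congr ?_
    filter_upwards [Ioi_mem_nhds h] with x hx
    exact (if_pos hx).symm

lemma integrableOn_posPow_sub_mul {β M : ℝ} (hβ : -1 < β) {f : ℝ → ℝ} (hf : Continuous f)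
    (hM : ∀ s, |f s| ≤ M) (t : ℝ) :
    IntegrableOn (fun s => posPow β (t - s) * f s) (Ioc 0 1) := by
  have h := (intervalIntegrable_posPow hβ (t - 0) (t - 1)).comp_sub_left t
  simp only [sub_sub_cancel] at h
  exact h.1.mul_bdd (c := M) hf.aestronglyMeasurable (.of_forall hM)

lemma continuousOn_integral_posPow_sub_mul {β M : ℝ} (hβ : -1 < β) {f : ℝ → ℝ}
    (hf : Continuous f) (hM : ∀ s, |f s| ≤ M) (hf0 : ∀ s ≤ 0, f s = 0) :
    ContinuousOn (fun t => ∫ s in Ioc (0:ℝ) 1, posPow β (t - s) * f s) (Iio 1) := by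
  set k : ℝ → ℝ := (Ioc (0:ℝ) 1).indicator (posPow β) with hk
  have hki : Integrable k :=
    (integrable_indicator_iff measurableSet_Ioc).2 (intervalIntegrable_posPow hβ 0 1).1
  have hcont : Continuous fun t => ∫ r, k r * f (t - r) := by
    refine continuous_of_dominated (bound := fun r => ‖k r‖ * M) (fun t => ?_) (fun t => ?_)
      (hki.norm.mul_const M) (.of_forall fun r => ?_)
    · exact hki.aestronglyMeasurable.mul (by fun_prop)
    · refine .of_forall fun r => ?_
      rw [norm_mul]
      exact mul_le_mul_of_nonneg_left (hM _) (norm_nonneg _)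
    · fun_prop
  refine hcont.continuousOn.congr fun t ht => ?_
  have e := integral_sub_left_eq_self (fun r => k r * f (t - r)) volume t
  simp only [sub_sub_cancel] at e
  simp only
  rw [← e, ← integral_indicator measurableSet_Ioc]
  refine integral_congr_ae (.of_forall fun s => ?_)
  have ht : t < 1 := ht
  by_cases h0 : s ≤ 0
  · simp [hf0 s h0]
  by_cases h1 : s ≤ 1
  · by_cases h2 : s < t
    · rw [indicator_of_mem (by grind), hk]
      simp only
      rw [indicator_of_mem (by grind)]
    · rw [indicator_of_mem (by grind), hk]
      simp only
      rw [indicator_of_notMem (by grind), posPow, if_neg (by linarith)]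
  · rw [indicator_of_notMem (by grind), hk]
    simp only
    rw [indicator_of_notMem (by grind), zero_mul]

lemma integrableOn_one_sub_rpow_mul {α : ℝ} (hα : 1 < α) {f : ℝ → ℝ} (hf : Continuous f) :
    IntegrableOn (fun s => (1 - s) ^ (α - 1) * f s) (Ioc 0 1) := by
  have hp : Continuous fun s : ℝ => (1 - s) ^ (α - 1) :=
    (continuous_const.sub continuous_id).rpow_const fun _ => Or.inr (by linarith)
  exact ((hp.mul hf).integrableOn_Icc (a := 0) (b := 1)).mono_set Ioc_subset_Icc_self

lemma integrableOn_fracGreenDeriv_mul_of_bounded {α M : ℝ} (hα : 1 < α) {f : ℝ → ℝ}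
    (hf : Continuous f) (hM : ∀ s, |f s| ≤ M) (t : ℝ) :
    IntegrableOn (fun s => fracGreenDeriv α t s * f s) (Ioc 0 1) := by
  have h1 := (integrableOn_one_sub_rpow_mul hα hf).const_mul (posPow (α - 2) t)
  have h2 := integrableOn_posPow_sub_mul (β := α - 2) (by linarith) hf hM t
  refine ((h1.sub h2).const_mul ((α - 1) / Real.Gamma α)).congr (.of_forall fun s => ?_)
  simp only [fracGreenDeriv, Pi.sub_apply]
  ring

lemma continuousOn_integral_fracGreenDeriv_of_bounded {α M : ℝ} (hα : 1 < α) {f : ℝ → ℝ}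
    (hf : Continuous f) (hM : ∀ s, |f s| ≤ M) (hf0 : ∀ s ≤ 0, f s = 0) :
    ContinuousOn (fun t => ∫ s in Ioc (0:ℝ) 1, fracGreenDeriv α t s * f s) (Ioo 0 1) := by
  have hp : ContinuousOn (posPow (α - 2)) (Ioo 0 1) := fun t ht =>
    (continuousAt_posPow ht.1.ne').continuousWithinAt
  have hc := (continuousOn_integral_posPow_sub_mul (β := α - 2) (by linarith) hf hM hf0).mono
    (Ioo_subset_Iio_self (a := 0))
  refine (((hp.mul_const (∫ s in Ioc (0:ℝ) 1, (1 - s) ^ (α - 1) * f s)).sub hc).const_mul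
    ((α - 1) / Real.Gamma α)).congr fun t _ => ?_
  simp only [Pi.sub_apply]
  rw [← integral_const_mul, ← integral_sub
    ((integrableOn_one_sub_rpow_mul hα hf).const_mul _)
    (integrableOn_posPow_sub_mul (by linarith) hf hM t), ← integral_const_mul]
  refine integral_congr_ae (.of_forall fun s => ?_)
  simp only [fracGreenDeriv]
  ring

section NearZero

variable {α δ : ℝ} {h : ℝ → ℝ}

lemma norm_fracGreenDeriv_mul_le (hα1 : 1 < α) (hα2 : α < 2) (h0 : ∀ s, δ < s → h s = 0)
    {s t : ℝ} (hs : 0 < s) (ht : 2 * δ < t) (ht1 : t ≤ 1) : ‖fracGreenDeriv α t s * h s‖ ≤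
      (α - 1) / Real.Gamma α * (δ ^ (α - 2) * (1 + 1 / δ)) * ‖s ^ (α - 1) * h s‖ := by
  rcases le_or_gt s δ with hsδ | hsδ
  · rw [norm_mul, norm_mul, ← mul_assoc, Real.norm_of_nonneg (Real.rpow_nonneg hs.le _)]
    exact mul_le_mul_of_nonneg_right (abs_fracGreenDeriv_le hα1 hα2 hs hsδ ht ht1) (norm_nonneg _)
  · simp [h0 s hsδ]

lemma aestronglyMeasurable_fracGreenDeriv_mul
    (hm : AEStronglyMeasurable h (volume.restrict (Ioc 0 1))) (t : ℝ) :
    AEStronglyMeasurable (fun s => fracGreenDeriv α t s * h s) (volume.restrict (Ioc 0 1)) :=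
  ((measurable_fracGreenDeriv α).comp measurable_prodMk_left).aestronglyMeasurable.mul hm

lemma integrableOn_fracGreenDeriv_mul_of_support (hα1 : 1 < α) (hα2 : α < 2)
    (hm : AEStronglyMeasurable h (volume.restrict (Ioc 0 1)))
    (hH : IntegrableOn (fun s => s ^ (α - 1) * h s) (Ioc 0 1)) (h0 : ∀ s, δ < s → h s = 0)
    {t : ℝ} (ht : 2 * δ < t) (ht1 : t ≤ 1) :
    IntegrableOn (fun s => fracGreenDeriv α t s * h s) (Ioc 0 1) := by
  refine (hH.norm.const_mul ((α - 1) / Real.Gamma α * (δ ^ (α - 2) * (1 + 1 / δ)))).mono'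
    (aestronglyMeasurable_fracGreenDeriv_mul hm t) ?_
  filter_upwards [ae_restrict_mem measurableSet_Ioc] with s hs
  exact norm_fracGreenDeriv_mul_le hα1 hα2 h0 hs.1 ht ht1

lemma continuousAt_integral_fracGreenDeriv_of_support (hα1 : 1 < α) (hα2 : α < 2)
    (hδ : 0 < δ) (hm : AEStronglyMeasurable h (volume.restrict (Ioc 0 1)))
    (hH : IntegrableOn (fun s => s ^ (α - 1) * h s) (Ioc 0 1)) (h0 : ∀ s, δ < s → h s = 0)
    {t : ℝ} (ht : 2 * δ < t) (ht1 : t < 1) :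
    ContinuousAt (fun t => ∫ s in Ioc (0:ℝ) 1, fracGreenDeriv α t s * h s) t := by
  refine continuousAt_of_dominated
    (.of_forall fun t => aestronglyMeasurable_fracGreenDeriv_mul hm t) ?_
    (hH.norm.const_mul ((α - 1) / Real.Gamma α * (δ ^ (α - 2) * (1 + 1 / δ))))
    (.of_forall fun s => ?_)
  · filter_upwards [Ioo_mem_nhds ht ht1] with t ht
    filter_upwards [ae_restrict_mem measurableSet_Ioc] with s hs
    exact norm_fracGreenDeriv_mul_le hα1 hα2 h0 hs.1 ht.1 ht.2.le
  · rcases le_or_gt s δ with hs | hs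
    · have h1 : ContinuousAt (posPow (α - 2)) t := continuousAt_posPow (by linarith)
      have h2 : ContinuousAt (fun t => posPow (α - 2) (t - s)) t :=
        ContinuousAt.comp (f := fun t => t - s) (continuousAt_posPow (by linarith))
          (by fun_prop)
      exact (((h1.mul_const _).sub h2).const_mul _).mul_const _
    · simp only [h0 s hs, mul_zero]
      exact continuousAt_const

end NearZero

lemma continuousOn_integral_fracGreenDeriv {α : ℝ} (hα1 : 1 < α) (hα2 : α < 2) {g : ℝ → ℝ}
    (hc : ContinuousOn g (Ioc 0 1)) (hH : IntegrableOn (fun s => s ^ (α - 1) * g s) (Ioc 0 1)) :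
    ContinuousOn (fun t => ∫ s in Ioc (0:ℝ) 1, fracGreenDeriv α t s * g s) (Ioo 0 1) := by
  intro t₀ ht₀
  obtain ⟨δ, hδ, hδt⟩ : ∃ δ > 0, 4 * δ < t₀ := ⟨t₀ / 8, by linarith [ht₀.1], by linarith [ht₀.1]⟩
  have hδ1 : δ ≤ 1 := by linarith [ht₀.2]
  -- a continuous cutoff, vanishing on `(-∞, δ]` and equal to `1` on `[2δ, ∞)`
  set φ : ℝ → ℝ := fun s => max 0 (min 1 ((s - δ) / δ)) with hφ
  set f : ℝ → ℝ := fun s => φ s * g (projIcc δ 1 hδ1 s) with hf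
  have hφc : Continuous φ := by fun_prop
  have hg : ContinuousOn g (Icc δ 1) := hc.mono fun s hs => ⟨hδ.trans_le hs.1, hs.2⟩
  have hfc : Continuous f :=
    hφc.mul (hg.comp_continuous (continuous_subtype_val.comp continuous_projIcc)
      fun s => (projIcc δ 1 hδ1 s).2)
  have hφ_nonneg : ∀ s, 0 ≤ φ s := fun s => le_max_left _ _
  have hφ_le : ∀ s, φ s ≤ 1 := fun s => max_le zero_le_one (min_le_left _ _)
  have hφ0 : ∀ s ≤ δ, φ s = 0 := fun s hs => by
    have : (s - δ) / δ ≤ 0 := div_nonpos_of_nonpos_of_nonneg (by linarith) hδ.le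
    exact max_eq_left (min_le_of_right_le this)
  have hφ1 : ∀ s, 2 * δ ≤ s → φ s = 1 := fun s hs => by
    have : 1 ≤ (s - δ) / δ := by rw [le_div_iff₀ hδ]; linarith
    simp [hφ, min_eq_left this]
  obtain ⟨M, hM⟩ : ∃ M, ∀ s, |f s| ≤ M := by
    obtain ⟨M, hM⟩ := isCompact_Icc.exists_bound_of_continuousOn hg
    refine ⟨M, fun s => ?_⟩
    have h1 := hM _ (projIcc δ 1 hδ1 s).2
    simp only [hf]
    rw [abs_mul, abs_of_nonneg (hφ_nonneg s)]
    exact (mul_le_of_le_one_left (abs_nonneg _) (hφ_le s)).trans h1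
  have hfg : ∀ s ∈ Ioc (0:ℝ) 1, f s = φ s * g s := fun s hs => by
    rcases le_or_gt s δ with h | h
    · simp [hf, hφ0 s h]
    · simp only [hf]
      rw [projIcc_of_mem hδ1 ⟨h.le, hs.2⟩]
  set h : ℝ → ℝ := fun s => (1 - φ s) * g s with hh
  have hm : AEStronglyMeasurable h (volume.restrict (Ioc 0 1)) :=
    (continuous_const.sub hφc).aestronglyMeasurable.mul
      (hc.aestronglyMeasurable measurableSet_Ioc)
  have hhH : IntegrableOn (fun s => s ^ (α - 1) * h s) (Ioc 0 1) := by
    refine (hH.bdd_mul (c := 1) (continuous_const.sub hφc).aestronglyMeasurable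
      (f := fun s => 1 - φ s) (.of_forall fun s => ?_)).congr (.of_forall fun s => ?_)
    · exact abs_le.2 ⟨by linarith [hφ_le s], by linarith [hφ_nonneg s]⟩
    · simp only [hh]
      ring
  have h0 : ∀ s, 2 * δ < s → h s = 0 := fun s hs => by simp [hh, hφ1 s hs.le]
  have hfcont := (continuousOn_integral_fracGreenDeriv_of_bounded hα1 hfc hM
    fun s hs => by simp [hf, hφ0 s (by linarith)]).continuousAt (Ioo_mem_nhds ht₀.1 ht₀.2)
  have hhcont := continuousAt_integral_fracGreenDeriv_of_support hα1 hα2 (δ := 2 * δ)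
    (by linarith) hm hhH h0 (t := t₀) (by linarith) ht₀.2
  refine ContinuousAt.continuousWithinAt ((hfcont.add hhcont).congr ?_)
  filter_upwards [Ioo_mem_nhds hδt ht₀.2] with t ht
  have hi := integrableOn_fracGreenDeriv_mul_of_support hα1 hα2 (δ := 2 * δ) hm hhH h0
    (t := t) (by linarith [ht.1]) ht.2.le
  simp only [Pi.add_apply]
  rw [← integral_add (integrableOn_fracGreenDeriv_mul_of_bounded hα1 hfc hM t) hi]
  refine setIntegral_congr_fun measurableSet_Ioc fun s hs => ?_
  simp only [hfg s hs, hh]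
  ring

theorem stmt10 (α : ℝ) (hα1 : 1 < α) (hα2 : α < 2) (g : ℝ → ℝ)
    (hc : ContinuousOn g (Ioc 0 1)) (hnn : ∀ s ∈ Ioc (0:ℝ) 1, 0 ≤ g s)
    (hH : IntegrableOn (fun s => s ^ (α - 1) * g s) (Ioc 0 1))
    (u : ℝ → ℝ) (hu : ∀ t, u t = ∫ s in Ioc (0:ℝ) 1, fracGreen α t s * g s) :
    (∀ t ∈ Ioo (0:ℝ) 1, DifferentiableAt ℝ u t) ∧
    IntegrableOn (fun t => |deriv u t|) (Ioo 0 1) ∧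
    (∫ t in Ioo (0:ℝ) 1, |deriv u t|)
      ≤ 2 * ∫ s in Ioc (0:ℝ) 1, s ^ (α - 1) * (1 - s) ^ (α - 1) * g s / Real.Gamma α ∧
    ∀ x ∈ Icc (0:ℝ) 1, u x = u 0 + ∫ t in (0:ℝ)..x, deriv u t := by
  set v : ℝ → ℝ := fun t => ∫ s in Ioc (0:ℝ) 1, fracGreenDeriv α t s * g s
  have hK := integrable_fracGreenDeriv_mul hα1 hα2 hc hH
  have hvc : ContinuousOn v (Ioo 0 1) := continuousOn_integral_fracGreenDeriv hα1 hα2 hc hH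
  have hvi : IntegrableOn v (Ioc 0 1) := hK.integral_prod_left
  have hux : ∀ x ∈ Icc (0:ℝ) 1, u x = ∫ t in (0:ℝ)..x, v t := by
    intro x hx
    have hKx : Integrable (fun z : ℝ × ℝ => fracGreenDeriv α z.1 z.2 * g z.2)
        ((volume.restrict (Ioc (0:ℝ) x)).prod (volume.restrict (Ioc (0:ℝ) 1))) := by
      rw [Measure.prod_restrict] at hK ⊢
      exact hK.mono_measure (Measure.restrict_mono_set _
        (prod_mono (Ioc_subset_Ioc_right hx.2) subset_rfl))
    rw [intervalIntegral.integral_of_le hx.1, hu, integral_integral_swap hKx]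
    refine setIntegral_congr_fun measurableSet_Ioc fun s hs => ?_
    rw [integral_mul_const, ← intervalIntegral.integral_of_le hx.1,
      integral_fracGreenDeriv hα1 hs hx.1]
  have hderiv : ∀ t ∈ Ioo (0:ℝ) 1, HasDerivAt u (v t) t := by
    intro t ht
    have hi : IntervalIntegrable v volume 0 t :=
      (intervalIntegrable_iff_integrableOn_Ioc_of_le ht.1.le).2
        (hvi.mono_set (Ioc_subset_Ioc_right ht.2.le))
    refine (intervalIntegral.integral_hasDerivAt_right hi
      (hvc.stronglyMeasurableAtFilter isOpen_Ioo t ht)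
      (hvc.continuousAt (Ioo_mem_nhds ht.1 ht.2))).congr_of_eventuallyEq ?_
    filter_upwards [Ioo_mem_nhds ht.1 ht.2] with x hx
    exact hux x ⟨hx.1.le, hx.2.le⟩
  have habs : EqOn (fun t => |deriv u t|) (fun t => |v t|) (Ioo 0 1) := fun t ht => by
    simp only [(hderiv t ht).deriv]
  refine ⟨fun t ht => (hderiv t ht).differentiableAt, ?_, ?_, fun x hx => ?_⟩
  · exact (IntegrableOn.congr_fun (hvi.mono_set Ioo_subset_Ioc_self).abs habs.symm
      measurableSet_Ioo)
  · rw [setIntegral_congr_fun measurableSet_Ioo habs, ← integral_Ioc_eq_integral_Ioo]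
    calc ∫ t in Ioc (0:ℝ) 1, |v t|
        ≤ ∫ t in Ioc (0:ℝ) 1, ∫ s in Ioc (0:ℝ) 1, ‖fracGreenDeriv α t s * g s‖ :=
          integral_mono hvi.abs hK.norm.integral_prod_left fun t =>
            norm_integral_le_integral_norm (fun s => fracGreenDeriv α t s * g s)
      _ = ∫ s in Ioc (0:ℝ) 1, ∫ t in Ioc (0:ℝ) 1, ‖fracGreenDeriv α t s * g s‖ :=
          integral_integral_swap hK.norm
      _ = ∫ s in Ioc (0:ℝ) 1,
            2 * (s ^ (α - 1) * (1 - s) ^ (α - 1) * g s / Real.Gamma α) := by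
          refine setIntegral_congr_fun measurableSet_Ioc fun s hs => ?_
          simp only [norm_mul, Real.norm_eq_abs, abs_of_nonneg (hnn s hs)]
          rw [integral_mul_const, ← intervalIntegral.integral_of_le zero_le_one,
            integral_abs_fracGreenDeriv hα1 hα2 hs]
          ring
      _ ≤ _ := (integral_const_mul _ _).le
  · have h0 : u 0 = 0 := by simpa using hux 0 (by simp)
    rw [h0, zero_add, hux x hx, intervalIntegral.integral_of_le hx.1,
      intervalIntegral.integral_of_le hx.1, integral_Ioc_eq_integral_Ioo,
      integral_Ioc_eq_integral_Ioo]
    exact setIntegral_congr_fun measurableSet_Ioo fun t ht =>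
      (hderiv t ⟨ht.1, ht.2.trans_le hx.2⟩).deriv.symm
end

section
/- Let α ∈ (1,2), g : (0,1] → [0,∞) continuous with ∫₀¹ s^(α-1) g(s) ds < ∞, and u(t) = ∫₀¹ G(t,s) g(s) ds. Then the Riemann–Liouville derivative of order α-1 of u satisfies D^{α-1}u(t) = ∫₀ᵗ ((1-τ)^(α-1) - 1) g(τ) dτ + ∫ₜ¹ (1-τ)^(α-1) g(τ) dτ for all t ∈ (0,1). -/
open MeasureTheory Set

/-- Riemann–Liouville fractional derivative of order `β ∈ (0,1)`. -/
noncomputable def RLderiv (β : ℝ) (u : ℝ → ℝ) (t : ℝ) : ℝ :=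
  (1 / Real.Gamma (1 - β)) * deriv (fun x => ∫ s in (0:ℝ)..x, (x - s) ^ (-β) * u s) t

/-- The Beta integral `∫₀ᵃ (a - t)^(-β) t^β dt`. -/
theorem integral_sub_rpow_neg_mul_rpow {β a : ℝ} (h0 : 0 < β) (h1 : β < 1) (ha : 0 ≤ a) :
    ∫ t in (0 : ℝ)..a, (a - t) ^ (-β) * t ^ β =
      Real.Gamma (1 - β) * Real.Gamma (β + 1) * a := by
  rcases ha.eq_or_lt with rfl | ha
  · simp
  have key := Complex.betaIntegral_scaled ((β + 1 : ℝ) : ℂ) ((1 - β : ℝ) : ℂ) ha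
  have hG := Complex.Gamma_mul_Gamma_eq_betaIntegral
    (s := ((β + 1 : ℝ) : ℂ)) (t := ((1 - β : ℝ) : ℂ))
    (by rw [Complex.ofReal_re]; linarith) (by rw [Complex.ofReal_re]; linarith)
  have hsum : ((β + 1 : ℝ) : ℂ) + ((1 - β : ℝ) : ℂ) = 2 := by push_cast; ring
  rw [hsum, Complex.Gamma_ofNat_eq_factorial, Complex.Gamma_ofReal, Complex.Gamma_ofReal] at hG
  rw [hsum] at key
  apply Complex.ofReal_injective
  rw [← intervalIntegral.integral_ofReal]
  have : ∫ t in (0 : ℝ)..a, (((a - t) ^ (-β) * t ^ β : ℝ) : ℂ) =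
      ∫ x in (0 : ℝ)..a, (x : ℂ) ^ (((β + 1 : ℝ) : ℂ) - 1) *
        ((a : ℂ) - x) ^ (((1 - β : ℝ) : ℂ) - 1) := by
    refine intervalIntegral.integral_congr fun t ht => ?_
    rw [uIcc_of_le ha.le] at ht
    have e1 : ((β + 1 : ℝ) : ℂ) - 1 = ((β : ℝ) : ℂ) := by push_cast; ring
    have e2 : ((1 - β : ℝ) : ℂ) - 1 = ((-β : ℝ) : ℂ) := by push_cast; ring
    simp only [e1, e2]
    rw [← Complex.ofReal_sub, ← Complex.ofReal_cpow ht.1,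
      ← Complex.ofReal_cpow (sub_nonneg.2 ht.2)]
    push_cast
    ring
  rw [this, key]
  norm_num at hG ⊢
  rw [mul_comm (a : ℂ), ← hG]
  ring

theorem intervalIntegrable_sub_rpow_neg {β x a b : ℝ} (h1 : β < 1) :
    IntervalIntegrable (fun t => (x - t) ^ (-β)) volume a b := by
  have := (intervalIntegral.intervalIntegrable_rpow' (r := -β) (a := x - a) (b := x - b)
    (by linarith)).comp_sub_left x
  simpa only [sub_sub_cancel] using this

theorem integral_sub_rpow_neg_mul_max_sub_rpow {β x s : ℝ} (h0 : 0 < β) (h1 : β < 1)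
    (hx : 0 ≤ x) (hs : 0 ≤ s) :
    ∫ t in (0 : ℝ)..x, (x - t) ^ (-β) * (max (t - s) 0) ^ β =
      Real.Gamma (1 - β) * Real.Gamma (β + 1) * max (x - s) 0 := by
  have hzero : ∀ y, 0 ≤ y → y ≤ s →
      ∫ t in (0 : ℝ)..y, (x - t) ^ (-β) * (max (t - s) 0) ^ β = 0 := by
    intro y hy hys
    rw [intervalIntegral.integral_congr (g := fun _ => (0 : ℝ))]
    · simp
    · intro t ht
      rw [uIcc_of_le hy] at ht
      simp only
      rw [max_eq_right (by linarith [ht.2]), Real.zero_rpow h0.ne', mul_zero]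
  rcases le_total x s with hxs | hsx
  · rw [hzero x hx hxs, max_eq_right (by linarith), mul_zero]
  have hint : ∀ a b, IntervalIntegrable
      (fun t => (x - t) ^ (-β) * (max (t - s) 0) ^ β) volume a b := fun a b =>
    (intervalIntegrable_sub_rpow_neg h1).mul_continuousOn
      (((continuous_id.sub continuous_const).max continuous_const).rpow_const
        fun _ => Or.inr h0.le).continuousOn
  rw [← intervalIntegral.integral_add_adjacent_intervals (hint 0 s) (hint s x),
    hzero s hs le_rfl, zero_add, max_eq_left (sub_nonneg.2 hsx),
    ← integral_sub_rpow_neg_mul_rpow h0 h1 (sub_nonneg.2 hsx)]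
  have := intervalIntegral.integral_comp_sub_right (a := s) (b := x)
    (fun t => (x - s - t) ^ (-β) * t ^ β) s
  rw [sub_self] at this
  rw [← this]
  refine intervalIntegral.integral_congr fun t ht => ?_
  rw [uIcc_of_le hsx] at ht
  rw [max_eq_left (sub_nonneg.2 ht.1), show x - s - (t - s) = x - t by ring]

theorem fracGreen_eq {α t s : ℝ} (hα : 1 < α) (ht : 0 ≤ t) (hs : s ≤ 1) :
    fracGreen α t s =
      (t ^ (α - 1) * (1 - s) ^ (α - 1) - (max (t - s) 0) ^ (α - 1)) / Real.Gamma α := by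
  rw [fracGreen, Real.mul_rpow ht (sub_nonneg.2 hs)]
  split_ifs with h
  · rw [max_eq_left (sub_nonneg.2 h)]
  · rw [max_eq_right (by linarith), Real.zero_rpow (by linarith), sub_zero]

theorem abs_fracGreen_le {α t s : ℝ} (hα1 : 1 < α) (hα2 : α < 2) (ht : t ∈ Icc (0 : ℝ) 1)
    (hs : s ∈ Icc (0 : ℝ) 1) : |fracGreen α t s| ≤ s ^ (α - 1) / Real.Gamma α := by
  obtain ⟨ht0, ht1⟩ := ht
  obtain ⟨hs0, hs1⟩ := hs
  have hβ : 0 ≤ α - 1 := by linarith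
  have hG : 0 < Real.Gamma α := Real.Gamma_pos_of_pos (by linarith)
  have hle : (t * (1 - s)) ^ (α - 1) ≤ t ^ (α - 1) :=
    Real.rpow_le_rpow (mul_nonneg ht0 (by linarith)) (by nlinarith) hβ
  rw [fracGreen]
  split_ifs with h
  · rw [abs_div, abs_of_pos hG]
    gcongr
    have h1 : (t - s) ^ (α - 1) ≤ (t * (1 - s)) ^ (α - 1) :=
      Real.rpow_le_rpow (by linarith) (by nlinarith) hβ
    have h2 : (t - s + s) ^ (α - 1) ≤ (t - s) ^ (α - 1) + s ^ (α - 1) :=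
      Real.rpow_add_le_add_rpow (by linarith) hs0 hβ (by linarith)
    rw [sub_add_cancel] at h2
    rw [abs_of_nonneg (by linarith)]
    linarith
  · rw [abs_div, abs_of_pos hG,
      abs_of_nonneg (Real.rpow_nonneg (mul_nonneg ht0 (by linarith)) _)]
    exact div_le_div_of_nonneg_right
      (hle.trans (Real.rpow_le_rpow ht0 (not_le.1 h).le hβ)) hG.le

theorem integral_sub_rpow_neg_mul_fracGreen {α x s : ℝ} (hα1 : 1 < α) (hα2 : α < 2)
    (hx : 0 ≤ x) (hs : s ∈ Icc (0 : ℝ) 1) :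
    ∫ t in (0 : ℝ)..x, (x - t) ^ (-(α - 1)) * fracGreen α t s =
      Real.Gamma (1 - (α - 1)) * (x * (1 - s) ^ (α - 1) - max (x - s) 0) := by
  have h0 : 0 < α - 1 := by linarith
  have h1 : α - 1 < 1 := by linarith
  have hG : Real.Gamma α ≠ 0 := (Real.Gamma_pos_of_pos (by linarith)).ne'
  have hI1 : IntervalIntegrable (fun t => (x - t) ^ (-(α - 1)) * t ^ (α - 1)) volume 0 x :=
    (intervalIntegrable_sub_rpow_neg h1).mul_continuousOn
      (continuous_id.rpow_const fun _ => Or.inr h0.le).continuousOn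
  have hI2 : IntervalIntegrable
      (fun t => (x - t) ^ (-(α - 1)) * (max (t - s) 0) ^ (α - 1)) volume 0 x :=
    (intervalIntegrable_sub_rpow_neg h1).mul_continuousOn
      (((continuous_id.sub continuous_const).max continuous_const).rpow_const
        fun _ => Or.inr h0.le).continuousOn
  have : ∫ t in (0 : ℝ)..x, (x - t) ^ (-(α - 1)) * fracGreen α t s =
      ∫ t in (0 : ℝ)..x, ((1 - s) ^ (α - 1) / Real.Gamma α *
          ((x - t) ^ (-(α - 1)) * t ^ (α - 1)) -
        1 / Real.Gamma α * ((x - t) ^ (-(α - 1)) * (max (t - s) 0) ^ (α - 1))) := by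
    refine intervalIntegral.integral_congr fun t ht => ?_
    rw [uIcc_of_le hx] at ht
    rw [fracGreen_eq hα1 ht.1 hs.2]
    ring
  rw [this, intervalIntegral.integral_sub (hI1.const_mul _) (hI2.const_mul _),
    intervalIntegral.integral_const_mul, intervalIntegral.integral_const_mul,
    integral_sub_rpow_neg_mul_rpow h0 h1 hx,
    integral_sub_rpow_neg_mul_max_sub_rpow h0 h1 hx hs.1, sub_add_cancel]
  field_simp

theorem measurable_fracGreen (α : ℝ) :
    Measurable (fun z : ℝ × ℝ => fracGreen α z.1 z.2) := by
  unfold fracGreen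
  refine Measurable.ite (measurableSet_le measurable_snd measurable_fst) ?_ ?_ <;> fun_prop

/-- Fubini's theorem gives the fractional integral of order `2 - α` of the Green potential. -/
theorem integral_sub_rpow_neg_mul_greenPotential {α x : ℝ} (hα1 : 1 < α) (hα2 : α < 2)
    {g : ℝ → ℝ} (hc : ContinuousOn g (Ioc 0 1))
    (hH : IntegrableOn (fun s => s ^ (α - 1) * g s) (Ioc 0 1)) (hx : x ∈ Icc (0 : ℝ) 1) :
    ∫ t in (0 : ℝ)..x, (x - t) ^ (-(α - 1)) * ∫ s in Ioc (0 : ℝ) 1, fracGreen α t s * g s =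
      Real.Gamma (1 - (α - 1)) *
        ∫ s in Ioc (0 : ℝ) 1, (x * (1 - s) ^ (α - 1) - max (x - s) 0) * g s := by
  have h1 : α - 1 < 1 := by linarith
  have hgm : AEStronglyMeasurable g (volume.restrict (Ioc (0 : ℝ) 1)) :=
    hc.aestronglyMeasurable measurableSet_Ioc
  have hk : IntegrableOn (fun t => (x - t) ^ (-(α - 1))) (Ioc 0 x) :=
    (intervalIntegrable_iff_integrableOn_Ioc_of_le hx.1).1 (intervalIntegrable_sub_rpow_neg h1)
  have hF : Integrable (Function.uncurry fun t s =>
      (x - t) ^ (-(α - 1)) * (fracGreen α t s * g s))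
      ((volume.restrict (Ioc (0 : ℝ) x)).prod (volume.restrict (Ioc (0 : ℝ) 1))) := by
    refine ((hk.mul_prod hH).norm.const_mul (1 / Real.Gamma α)).mono' ?_ ?_
    · refine AEStronglyMeasurable.mul ?_ (AEStronglyMeasurable.mul ?_ hgm.comp_snd)
      · exact hk.aestronglyMeasurable.comp_fst
      · exact (measurable_fracGreen α).aestronglyMeasurable
    · rw [Measure.prod_restrict]
      filter_upwards [ae_restrict_mem (measurableSet_Ioc.prod measurableSet_Ioc)]
        with ⟨t, s⟩ ⟨ht, hs⟩
      simp only at ht hs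
      have hb := abs_fracGreen_le hα1 hα2 (t := t) (s := s)
        ⟨ht.1.le, ht.2.trans hx.2⟩ ⟨hs.1.le, hs.2⟩
      simp only [Function.uncurry, Real.norm_eq_abs, abs_mul]
      rw [abs_of_nonneg (Real.rpow_nonneg hs.1.le (α - 1))]
      calc |(x - t) ^ (-(α - 1))| * (|fracGreen α t s| * |g s|)
          ≤ |(x - t) ^ (-(α - 1))| * (s ^ (α - 1) / Real.Gamma α * |g s|) := by gcongr
        _ = _ := by ring
  calc _ = ∫ t in Ioc (0 : ℝ) x, ∫ s in Ioc (0 : ℝ) 1,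
          (x - t) ^ (-(α - 1)) * (fracGreen α t s * g s) := by
        rw [intervalIntegral.integral_of_le hx.1]
        simp_rw [integral_const_mul]
    _ = ∫ s in Ioc (0 : ℝ) 1, ∫ t in Ioc (0 : ℝ) x,
          (x - t) ^ (-(α - 1)) * (fracGreen α t s * g s) := integral_integral_swap hF
    _ = ∫ s in Ioc (0 : ℝ) 1, Real.Gamma (1 - (α - 1)) *
          ((x * (1 - s) ^ (α - 1) - max (x - s) 0) * g s) := by
        refine setIntegral_congr_fun measurableSet_Ioc fun s hs => ?_
        simp_rw [← mul_assoc]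
        rw [integral_mul_const, ← intervalIntegral.integral_of_le hx.1,
          integral_sub_rpow_neg_mul_fracGreen hα1 hα2 hx.1 ⟨hs.1.le, hs.2⟩]
    _ = _ := integral_const_mul _ _

theorem abs_kernel_le {β s x : ℝ} (h0 : 0 < β) (h1 : β < 1) (hx : x ∈ Icc (0 : ℝ) 1)
    (hs : s ∈ Ioc (0 : ℝ) 1) : |x * (1 - s) ^ β - max (x - s) 0| ≤ s ^ β := by
  obtain ⟨hx0, hx1⟩ := hx
  obtain ⟨hs0, hs1⟩ := hs
  have ha1 : (1 - s) ^ β ≤ 1 := Real.rpow_le_one (by linarith) (by linarith) h0.le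
  have hl : 1 - s ≤ (1 - s) ^ β :=
    Real.self_le_rpow_of_le_one (by linarith) (by linarith) h1.le
  have hr : s ≤ s ^ β := Real.self_le_rpow_of_le_one hs0.le hs1 h1.le
  rw [abs_le]
  rcases le_total s x with h | h
  · rw [max_eq_left (by linarith)]
    constructor <;> nlinarith
  · rw [max_eq_right (by linarith)]
    constructor <;> nlinarith

/-- The difference quotients in `x` of `x (1 - s)^β - (x - s)₊` are controlled by `s ^ β`
for `x` bounded away from `0`. -/
theorem abs_kernel_sub_le {β c s x y : ℝ} (h0 : 0 < β) (h1 : β < 1) (hc : c ∈ Ioo (0 : ℝ) 1)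
    (hs : s ∈ Ioc (0 : ℝ) 1) (hx : c ≤ x) (hy : c ≤ y) :
    |(x * (1 - s) ^ β - max (x - s) 0) - (y * (1 - s) ^ β - max (y - s) 0)| ≤
      2 / c ^ β * s ^ β * |x - y| := by
  have ha0 : 0 ≤ (1 - s) ^ β := Real.rpow_nonneg (by linarith [hs.2]) _
  have ha1 : (1 - s) ^ β ≤ 1 :=
    Real.rpow_le_one (by linarith [hs.2]) (by linarith [hs.1]) h0.le
  have hcβ : 0 < c ^ β := Real.rpow_pos_of_pos hc.1 _
  have hcβ1 : c ^ β ≤ 1 := Real.rpow_le_one hc.1.le hc.2.le h0.le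
  have hsβ : 0 ≤ s ^ β := Real.rpow_nonneg hs.1.le _
  rcases le_or_gt s c with hsc | hcs
  · rw [max_eq_left (by linarith), max_eq_left (by linarith),
      show x * (1 - s) ^ β - (x - s) - (y * (1 - s) ^ β - (y - s)) =
        ((1 - s) ^ β - 1) * (x - y) by ring, abs_mul]
    gcongr
    have hl : 1 - s ≤ (1 - s) ^ β :=
      Real.self_le_rpow_of_le_one (by linarith [hs.2]) (by linarith [hs.1]) h1.le
    have hr : s ≤ s ^ β := Real.self_le_rpow_of_le_one hs.1.le hs.2 h1.le
    have h2 : 1 ≤ 2 / c ^ β := by rw [le_div_iff₀ hcβ]; linarith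
    rw [abs_of_nonpos (by linarith)]
    nlinarith
  · have hratio : 2 ≤ 2 / c ^ β * s ^ β := by
      rw [div_mul_eq_mul_div, le_div_iff₀ hcβ]
      have := Real.rpow_le_rpow hc.1.le hcs.le h0.le
      linarith
    have hm := abs_max_sub_max_le_abs (x - s) (y - s) 0
    rw [show x - s - (y - s) = x - y by ring] at hm
    rw [show x * (1 - s) ^ β - max (x - s) 0 - (y * (1 - s) ^ β - max (y - s) 0) =
        (1 - s) ^ β * (x - y) - (max (x - s) 0 - max (y - s) 0) by ring]
    have hab := abs_sub ((1 - s) ^ β * (x - y)) (max (x - s) 0 - max (y - s) 0)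
    rw [abs_mul, abs_of_nonneg ha0] at hab
    have hxy := abs_nonneg (x - y)
    nlinarith

theorem hasDerivAt_kernel {β s t : ℝ} (hst : s ≠ t) :
    HasDerivAt (fun x => x * (1 - s) ^ β - max (x - s) 0)
      ((1 - s) ^ β - if s ≤ t then 1 else 0) t := by
  have hmul : HasDerivAt (fun x => x * (1 - s) ^ β) ((1 - s) ^ β) t := by
    simpa using (hasDerivAt_id t).mul_const ((1 - s) ^ β)
  refine hmul.sub ?_
  rcases hst.lt_or_gt with h | h
  · rw [if_pos h.le]
    refine ((hasDerivAt_id t).sub_const s).congr_of_eventuallyEq ?_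
    filter_upwards [lt_mem_nhds h] with x hx
    simp [hx.le]
  · rw [if_neg h.not_ge]
    refine (hasDerivAt_const t (0 : ℝ)).congr_of_eventuallyEq ?_
    filter_upwards [gt_mem_nhds h] with x hx
    exact max_eq_right (by linarith)

theorem hasDerivAt_integral_kernel_mul {β t : ℝ} (h0 : 0 < β) (h1 : β < 1) {g : ℝ → ℝ}
    (hc : ContinuousOn g (Ioc 0 1))
    (hH : IntegrableOn (fun s => s ^ β * g s) (Ioc 0 1)) (ht : t ∈ Ioo (0 : ℝ) 1) :
    IntegrableOn (fun s => ((1 - s) ^ β - if s ≤ t then 1 else 0) * g s) (Ioc 0 1) ∧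
    HasDerivAt (fun x => ∫ s in Ioc (0 : ℝ) 1, (x * (1 - s) ^ β - max (x - s) 0) * g s)
      (∫ s in Ioc (0 : ℝ) 1, ((1 - s) ^ β - if s ≤ t then 1 else 0) * g s) t := by
  have hgm : AEStronglyMeasurable g (volume.restrict (Ioc (0 : ℝ) 1)) :=
    hc.aestronglyMeasurable measurableSet_Ioc
  have hmeas : ∀ x : ℝ, AEStronglyMeasurable
      (fun s => (x * (1 - s) ^ β - max (x - s) 0) * g s) (volume.restrict (Ioc (0 : ℝ) 1)) :=
    fun x => AEStronglyMeasurable.mul (Measurable.aestronglyMeasurable (by fun_prop)) hgm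
  have hbound : Integrable (fun s => 2 / (t / 2) ^ β * |s ^ β * g s|)
      (volume.restrict (Ioc (0 : ℝ) 1)) := hH.abs.const_mul _
  have hc2 : t / 2 ∈ Ioo (0 : ℝ) 1 := ⟨by linarith [ht.1], by linarith [ht.1, ht.2]⟩
  refine hasDerivAt_integral_of_dominated_loc_of_lip (s := Ici (t / 2))
    (bound := fun s => 2 / (t / 2) ^ β * |s ^ β * g s|)
    (Ici_mem_nhds (by linarith [ht.1])) (.of_forall hmeas) ?_ ?_ ?_ hbound ?_
  · refine hH.abs.mono' (hmeas t) ?_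
    filter_upwards [ae_restrict_mem measurableSet_Ioc] with s hs
    rw [Real.norm_eq_abs, abs_mul, abs_mul, abs_of_nonneg (Real.rpow_nonneg hs.1.le β)]
    gcongr
    exact abs_kernel_le h0 h1 ⟨ht.1.le, ht.2.le⟩ hs
  · exact AEStronglyMeasurable.mul (Measurable.aestronglyMeasurable
      (Measurable.sub (by fun_prop)
        (Measurable.ite measurableSet_Iic measurable_const measurable_const))) hgm
  · filter_upwards [ae_restrict_mem measurableSet_Ioc] with s hs
    refine LipschitzOnWith.of_dist_le_mul fun x hx y hy => ?_
    have hnn : 0 ≤ 2 / (t / 2) ^ β * |s ^ β * g s| :=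
      mul_nonneg (div_nonneg zero_le_two (Real.rpow_nonneg hc2.1.le _)) (abs_nonneg _)
    rw [Real.coe_nnabs, abs_of_nonneg hnn, Real.dist_eq, Real.dist_eq, ← sub_mul, abs_mul,
      abs_mul, abs_of_nonneg (Real.rpow_nonneg hs.1.le β)]
    calc _ ≤ 2 / (t / 2) ^ β * s ^ β * |x - y| * |g s| := by
          gcongr
          exact abs_kernel_sub_le h0 h1 hc2 hs hx hy
      _ = _ := by ring
  · filter_upwards [Measure.ae_ne (volume.restrict (Ioc (0 : ℝ) 1)) t] with s hs
    exact (hasDerivAt_kernel hs).mul_const (g s)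

theorem stmt11 (α : ℝ) (hα1 : 1 < α) (hα2 : α < 2) (g : ℝ → ℝ)
    (hc : ContinuousOn g (Ioc 0 1)) (hnn : ∀ s ∈ Ioc (0:ℝ) 1, 0 ≤ g s)
    (hH : IntegrableOn (fun s => s ^ (α - 1) * g s) (Ioc 0 1))
    (u : ℝ → ℝ) (hu : ∀ t, u t = ∫ s in Ioc (0:ℝ) 1, fracGreen α t s * g s) :
    ∀ t ∈ Ioo (0:ℝ) 1,
      RLderiv (α - 1) u t =
        (∫ τ in Ioc (0:ℝ) t, ((1 - τ) ^ (α - 1) - 1) * g τ) +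
          ∫ τ in Ioc t 1, (1 - τ) ^ (α - 1) * g τ := by
  intro t ht
  have hG : Real.Gamma (1 - (α - 1)) ≠ 0 := (Real.Gamma_pos_of_pos (by linarith)).ne'
  obtain ⟨hint, hderiv⟩ := hasDerivAt_integral_kernel_mul (β := α - 1) (by linarith)
    (by linarith) hc hH ht
  have heq : (fun x => ∫ s in (0 : ℝ)..x, (x - s) ^ (-(α - 1)) * u s) =ᶠ[nhds t]
      fun x => Real.Gamma (1 - (α - 1)) *
        ∫ s in Ioc (0 : ℝ) 1, (x * (1 - s) ^ (α - 1) - max (x - s) 0) * g s := by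
    filter_upwards [Icc_mem_nhds ht.1 ht.2] with x hx
    simp_rw [hu]
    exact integral_sub_rpow_neg_mul_greenPotential hα1 hα2 hc hH hx
  rw [RLderiv, heq.deriv_eq, (hderiv.const_mul _).deriv, ← mul_assoc, one_div_mul_cancel hG,
    one_mul]
  have hU : Ioc (0 : ℝ) t ∪ Ioc t 1 = Ioc 0 1 := Ioc_union_Ioc_eq_Ioc ht.1.le ht.2.le
  rw [← hU] at hint ⊢
  rw [setIntegral_union (Ioc_disjoint_Ioc_of_le le_rfl) measurableSet_Ioc
    hint.left_of_union hint.right_of_union]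
  congr 1
  · refine setIntegral_congr_fun measurableSet_Ioc fun s hs => ?_
    simp only [if_pos hs.2]
  · refine setIntegral_congr_fun measurableSet_Ioc fun s hs => ?_
    simp only [if_neg hs.1.not_ge, sub_zero]
end

section
/- Let α ∈ (1,2] and h ∈ C[0,1] nonnegative, and let u(t) = ∫₀¹ G(t,s) h(s) ds with G the fractional Green's function. Then t^{2-α} u'(t) is bounded on (0,1]: |t^{2-α} u'(t)| ≤ M [∫₀ᵗ ((α-1)/Γ(α)) ((1-s)^(α-1) + (1-s/t)^(α-2)) ds + ∫ₜ¹ ((α-1)/Γ(α)) (1-s)^(α-1) ds] < ∞ where M = ‖h‖_∞; consequently u ∈ C¹_{2-α}[0,1]. -/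
open MeasureTheory Set

theorem intervalIntegrable_one_sub_rpow {β : ℝ} (hβ : 0 < β) :
    IntervalIntegrable (fun σ : ℝ => (1 - σ) ^ (β - 1)) volume 0 1 := by
  have h1 : IntervalIntegrable (fun x : ℝ => x ^ (β - 1)) volume 0 1 :=
    intervalIntegral.intervalIntegrable_rpow' (by linarith)
  have h2 := (h1.comp_sub_left 1).symm
  simpa using h2

theorem continuous_integral_one_sub_rpow_mul {β : ℝ} (hβ : 0 < β) {H : ℝ → ℝ}
    (hH : Continuous H) {M : ℝ} (hM : ∀ x, |H x| ≤ M) :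
    Continuous fun r : ℝ => ∫ σ in (0 : ℝ)..1, (1 - σ) ^ (β - 1) * H (r * σ) := by
  refine intervalIntegral.continuous_of_dominated_interval
    (bound := fun σ => |(1 - σ) ^ (β - 1)| * M) (fun r => ?_) (fun r => ?_) ?_ ?_
  · exact (Measurable.mul (by fun_prop) (hH.measurable.comp (by fun_prop))).aestronglyMeasurable
  · refine Filter.Eventually.of_forall fun σ _ => ?_
    rw [norm_mul, Real.norm_eq_abs, Real.norm_eq_abs]
    exact mul_le_mul_of_nonneg_left (hM _) (abs_nonneg _)
  · exact (intervalIntegrable_one_sub_rpow hβ).abs.mul_const M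
  · exact Filter.Eventually.of_forall fun σ _ => by fun_prop

/-- Rescaling a Riemann–Liouville integral to the unit interval. -/
theorem rpow_mul_integral_one_sub_rpow_mul (β : ℝ) (H : ℝ → ℝ) {r : ℝ} (hr : 0 < r) :
    r ^ β * ∫ σ in (0 : ℝ)..1, (1 - σ) ^ (β - 1) * H (r * σ) =
      ∫ s in (0 : ℝ)..r, (r - s) ^ (β - 1) * H s := by
  have h1 := intervalIntegral.mul_integral_comp_mul_left (a := 0) (b := 1)
    (f := fun s => (r - s) ^ (β - 1) * H s) r
  simp only [mul_zero, mul_one] at h1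
  rw [← h1, show β = 1 + (β - 1) by ring, Real.rpow_add hr, Real.rpow_one, mul_assoc,
    ← intervalIntegral.integral_const_mul, add_sub_cancel_left]
  congr 1
  refine intervalIntegral.integral_congr fun σ hσ => ?_
  rw [uIcc_of_le zero_le_one] at hσ
  have : r - r * σ = r * (1 - σ) := by ring
  simp only [this]
  rw [Real.mul_rpow hr.le (by linarith [hσ.2]), mul_assoc]

theorem integral_integral_sub_rpow_mul {β : ℝ} (hβ : 0 < β) {H : ℝ → ℝ}
    (hH : Continuous H) {t : ℝ} (ht : t ∈ Icc (0 : ℝ) 1) :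
    ∫ r in (0 : ℝ)..t, ∫ s in (0 : ℝ)..r, (r - s) ^ (β - 1) * H s =
      ∫ s in (0 : ℝ)..t, (t - s) ^ β / β * H s := by
  set f : ℝ → ℝ := (Ioc (0 : ℝ) 1).indicator H with hf
  set g : ℝ → ℝ := (Ioc (0 : ℝ) 1).indicator fun x => x ^ (β - 1) with hg
  have hfi : Integrable f := by
    rw [hf, integrable_indicator_iff measurableSet_Ioc]
    exact (hH.intervalIntegrable 0 1).1
  have hgi : Integrable g := by
    rw [hg, integrable_indicator_iff measurableSet_Ioc]
    exact (intervalIntegral.intervalIntegrable_rpow' (a := 0) (b := 1)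
      (by linarith : -1 < β - 1)).1
  have hprod : Integrable (fun p : ℝ × ℝ => f p.2 * g (p.1 - p.2))
      ((volume.restrict (Ioc 0 t)).prod volume) := by
    have h1 := hfi.convolution_integrand (ContinuousLinearMap.mul ℝ ℝ) hgi
    have h2 : Integrable (fun p : ℝ × ℝ => f p.2 * g (p.1 - p.2)) (volume.prod volume) := h1
    exact h2.mono_measure (Measure.prod_mono Measure.restrict_le_self le_rfl)
  have hswap := integral_integral_swap (f := fun r s => f s * g (r - s)) hprod
  rw [intervalIntegral.integral_of_le ht.1, intervalIntegral.integral_of_le ht.1]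
  have hleft : ∀ r ∈ Ioc 0 t,
      ∫ s in (0 : ℝ)..r, (r - s) ^ (β - 1) * H s = ∫ s, f s * g (r - s) := by
    intro r hr
    rw [intervalIntegral.integral_of_le hr.1.le, integral_Ioc_eq_integral_Ioo,
      ← integral_indicator measurableSet_Ioo]
    congr 1 with s
    have hr1 := hr.2.trans ht.2
    by_cases hs : s ∈ Ioo 0 r
    · have h1 : s ∈ Ioc (0 : ℝ) 1 := ⟨hs.1, by linarith [hs.2]⟩
      have h2 : r - s ∈ Ioc (0 : ℝ) 1 := ⟨by linarith [hs.2], by linarith [hs.1]⟩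
      rw [hf, hg, indicator_of_mem hs, indicator_of_mem h1, indicator_of_mem h2, mul_comm]
    · rw [indicator_of_notMem hs]
      by_cases h1 : s ∈ Ioc (0 : ℝ) 1
      · have h2 : r - s ∉ Ioc (0 : ℝ) 1 := fun h2 => hs ⟨h1.1, by linarith [h2.1]⟩
        rw [hg, indicator_of_notMem h2, mul_zero]
      · rw [hf, indicator_of_notMem h1, zero_mul]
  rw [setIntegral_congr_fun measurableSet_Ioc hleft, hswap, ← integral_indicator measurableSet_Ioc]
  congr 1 with s
  rw [integral_const_mul]
  by_cases hs : s ∈ Ioc (0 : ℝ) 1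
  · have hgs : ∫ r in Ioc 0 t, g (r - s) = ∫ x in Ioc 0 (t - s), x ^ (β - 1) := by
      rw [← intervalIntegral.integral_of_le ht.1, intervalIntegral.integral_comp_sub_right,
        intervalIntegral.integral_of_le (by linarith [ht.1]), hg,
        setIntegral_indicator measurableSet_Ioc]
      congr 2
      ext x
      simp only [mem_inter_iff, mem_Ioc]
      constructor
      · rintro ⟨⟨-, h1⟩, h2, -⟩
        exact ⟨h2, h1⟩
      · rintro ⟨h1, h2⟩
        exact ⟨⟨by linarith [hs.1], h2⟩, h1, by linarith [hs.1, ht.2]⟩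
    rw [hgs]
    by_cases hst : s ≤ t
    · rw [indicator_of_mem (show s ∈ Ioc 0 t from ⟨hs.1, hst⟩), hf, indicator_of_mem hs,
        ← intervalIntegral.integral_of_le (by linarith), integral_rpow (Or.inl (by linarith))]
      simp [Real.zero_rpow hβ.ne', mul_comm]
    · rw [indicator_of_notMem (fun h => hst h.2), Ioc_eq_empty (by linarith)]
      simp
  · rw [hf, indicator_of_notMem hs, zero_mul,
      indicator_of_notMem (fun h => hs ⟨h.1, h.2.trans ht.2⟩)]

/-- The Riemann–Liouville integral of order `β + 1` as a primitive of a continuous function. -/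
theorem integral_rpow_mul_integral_one_sub_rpow_mul {β : ℝ} (hβ : 0 < β) {H : ℝ → ℝ}
    (hH : Continuous H) {t : ℝ} (ht : t ∈ Icc (0 : ℝ) 1) :
    β * ∫ r in (0 : ℝ)..t, r ^ β * ∫ σ in (0 : ℝ)..1, (1 - σ) ^ (β - 1) * H (r * σ) =
      ∫ s in (0 : ℝ)..t, (t - s) ^ β * H s := by
  have h1 : ∫ r in (0 : ℝ)..t, r ^ β * ∫ σ in (0 : ℝ)..1, (1 - σ) ^ (β - 1) * H (r * σ) =
      ∫ r in (0 : ℝ)..t, ∫ s in (0 : ℝ)..r, (r - s) ^ (β - 1) * H s := by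
    rw [intervalIntegral.integral_of_le ht.1, intervalIntegral.integral_of_le ht.1]
    exact setIntegral_congr_fun measurableSet_Ioc
      fun r hr => rpow_mul_integral_one_sub_rpow_mul β H hr.1
  rw [h1, integral_integral_sub_rpow_mul hβ hH ht, ← intervalIntegral.integral_const_mul]
  congr 1 with s
  field_simp

theorem integral_fracGreen_mul {α : ℝ} (hα : 1 < α) {H : ℝ → ℝ} (hH : Continuous H)
    {t : ℝ} (ht : t ∈ Icc (0 : ℝ) 1) :
    ∫ s in Ioc (0 : ℝ) 1, fracGreen α t s * H s =
      (t ^ (α - 1) * (∫ s in (0 : ℝ)..1, (1 - s) ^ (α - 1) * H s) -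
        ∫ s in (0 : ℝ)..t, (t - s) ^ (α - 1) * H s) / Real.Gamma α := by
  have hα' : 0 ≤ α - 1 := by linarith
  have hpt : ∀ s ∈ Ioc (0 : ℝ) 1, fracGreen α t s * H s =
      (t ^ (α - 1) * ((1 - s) ^ (α - 1) * H s) -
        (Ioc 0 t).indicator (fun s => (t - s) ^ (α - 1) * H s) s) / Real.Gamma α := by
    intro s hs
    unfold fracGreen
    rw [Real.mul_rpow ht.1 (by linarith [hs.2])]
    split_ifs with hst
    · rw [indicator_of_mem (show s ∈ Ioc 0 t from ⟨hs.1, hst⟩)]; ring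
    · rw [indicator_of_notMem (fun h => hst h.2)]; ring
  have hc : ∀ a : ℝ, Continuous fun s : ℝ => (a - s) ^ (α - 1) * H s := fun a =>
    ((continuous_const.sub continuous_id).rpow_const fun _ => Or.inr hα').mul hH
  rw [setIntegral_congr_fun measurableSet_Ioc hpt, integral_div, integral_sub,
    integral_const_mul, setIntegral_indicator measurableSet_Ioc,
    intervalIntegral.integral_of_le zero_le_one, intervalIntegral.integral_of_le ht.1,
    inter_eq_right.2 (Ioc_subset_Ioc_right ht.2)]
  · exact ((hc 1).intervalIntegrable 0 1).1.const_mul _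
  · exact (((hc t).intervalIntegrable 0 1).1).indicator measurableSet_Ioc

theorem stmt18 (α : ℝ) (hα1 : 1 < α) (hα2 : α ≤ 2) (h : ℝ → ℝ)
    (hc : ContinuousOn h (Icc 0 1)) (hnn : ∀ t ∈ Icc (0:ℝ) 1, 0 ≤ h t)
    (M : ℝ) (hM : ∀ t ∈ Icc (0:ℝ) 1, |h t| ≤ M)
    (u : ℝ → ℝ) (hu : ∀ t, u t = ∫ s in Ioc (0:ℝ) 1, fracGreen α t s * h s) :
    (∀ t ∈ Ioc (0:ℝ) 1,
      |t ^ (2 - α) * deriv u t| ≤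
        M * ((∫ s in (0:ℝ)..t, (α - 1) / Real.Gamma α * ((1 - s) ^ (α - 1) + (1 - s / t) ^ (α - 2))) +
          ∫ s in t..(1:ℝ), (α - 1) / Real.Gamma α * (1 - s) ^ (α - 1))) ∧
    ∃ v : ℝ → ℝ, ContinuousOn v (Icc 0 1) ∧
      ∀ t ∈ Ioo (0:ℝ) 1, v t = t ^ (2 - α) * deriv u t := by
  have hβ : 0 < α - 1 := by linarith
  have hΓ : 0 < Real.Gamma α := Real.Gamma_pos_of_pos (by linarith)
  have hM0 : 0 ≤ M := (abs_nonneg _).trans (hM 0 ⟨le_rfl, zero_le_one⟩)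
  set H : ℝ → ℝ := IccExtend zero_le_one ((Icc (0 : ℝ) 1).domRestrict h)
  have hHh : ∀ s ∈ Icc (0 : ℝ) 1, H s = h s := fun s hs => IccExtend_of_mem _ _ hs
  have hH : Continuous H := hc.domRestrict.Icc_extend'
  have hHM : ∀ x, |H x| ≤ M := fun x => hM _ (projIcc 0 1 zero_le_one x).2
  set W : ℝ → ℝ := fun r => ∫ σ in (0 : ℝ)..1, (1 - σ) ^ (α - 1 - 1) * H (r * σ) with hW
  have hWc : Continuous W := continuous_integral_one_sub_rpow_mul hβ hH hHM
  set A : ℝ := ∫ s in (0 : ℝ)..1, (1 - s) ^ (α - 1) * H s with hA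
  set U : ℝ → ℝ := fun t =>
    (t ^ (α - 1) * A - (α - 1) * ∫ r in (0 : ℝ)..t, r ^ (α - 1) * W r) / Real.Gamma α with hU
  have huU : EqOn u U (Icc 0 1) := by
    intro t ht
    rw [hu, hU, hW]
    simp only
    rw [integral_rpow_mul_integral_one_sub_rpow_mul hβ hH ht, hA,
      ← integral_fracGreen_mul hα1 hH ht]
    exact setIntegral_congr_fun measurableSet_Ioc fun s hs => by
      simp only [hHh s (Ioc_subset_Icc_self hs)]
  have hUd : ∀ t, 0 < t → HasDerivAt U
      (((α - 1) * t ^ (α - 1 - 1) * A - (α - 1) * (t ^ (α - 1) * W t)) / Real.Gamma α) t := by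
    intro t ht
    have hcont : Continuous fun r : ℝ => r ^ (α - 1) * W r :=
      (continuous_id.rpow_const fun _ => Or.inr hβ.le).mul hWc
    exact (((Real.hasDerivAt_rpow_const (Or.inl ht.ne')).mul_const A).sub
      ((hcont.integral_hasStrictDerivAt 0 t).hasDerivAt.const_mul _)).div_const _
  have hUv : ∀ t, 0 < t → t ^ (2 - α) * (((α - 1) * t ^ (α - 1 - 1) * A -
      (α - 1) * (t ^ (α - 1) * W t)) / Real.Gamma α) =
        (α - 1) / Real.Gamma α * (A - t * W t) := by
    intro t ht
    have e1 : t ^ (2 - α) * t ^ (α - 1 - 1) = 1 := by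
      rw [← Real.rpow_add ht, show 2 - α + (α - 1 - 1) = 0 by ring, Real.rpow_zero]
    have e2 : t ^ (2 - α) * t ^ (α - 1) = t := by
      rw [← Real.rpow_add ht, show 2 - α + (α - 1) = 1 by ring, Real.rpow_one]
    linear_combination (α - 1) / Real.Gamma α * A * e1 - (α - 1) / Real.Gamma α * W t * e2
  have hc1 (a b : ℝ) : IntervalIntegrable (fun s : ℝ => (1 - s) ^ (α - 1)) volume a b :=
    ((continuous_const.sub continuous_id).rpow_const
      fun _ => Or.inr hβ.le).intervalIntegrable a b
  set I : ℝ := ∫ s in (0 : ℝ)..1, (1 - s) ^ (α - 1) with hI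
  set J : ℝ := ∫ s in (0 : ℝ)..1, (1 - s) ^ (α - 1 - 1) with hJ
  have hAb : |A| ≤ M * I := by
    rw [← Real.norm_eq_abs, hA, hI, ← intervalIntegral.integral_const_mul]
    refine intervalIntegral.norm_integral_le_of_norm_le zero_le_one
      (Filter.Eventually.of_forall fun s hs => ?_) ((hc1 0 1).const_mul M)
    have := Real.rpow_nonneg (sub_nonneg.2 hs.2) (α - 1)
    rw [norm_mul, Real.norm_of_nonneg this, mul_comm]
    exact mul_le_mul_of_nonneg_right (hHM s) this
  have hWb : ∀ t, |W t| ≤ M * J := by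
    intro t
    rw [← Real.norm_eq_abs, hJ, ← intervalIntegral.integral_const_mul]
    refine intervalIntegral.norm_integral_le_of_norm_le zero_le_one
      (Filter.Eventually.of_forall fun s hs => ?_)
      ((intervalIntegrable_one_sub_rpow hβ).const_mul M)
    have := Real.rpow_nonneg (sub_nonneg.2 hs.2) (α - 1 - 1)
    rw [norm_mul, Real.norm_of_nonneg this, mul_comm]
    exact mul_le_mul_of_nonneg_right (hHM _) this
  have hI0 : 0 ≤ I := intervalIntegral.integral_nonneg zero_le_one
    fun s hs => Real.rpow_nonneg (sub_nonneg.2 hs.2) _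
  have hJ0 : 0 ≤ J := intervalIntegral.integral_nonneg zero_le_one
    fun s hs => Real.rpow_nonneg (sub_nonneg.2 hs.2) _
  have hrhs : ∀ t ∈ Ioc (0 : ℝ) 1,
      (∫ s in (0:ℝ)..t, (α - 1) / Real.Gamma α * ((1 - s) ^ (α - 1) + (1 - s / t) ^ (α - 2))) +
        ∫ s in t..(1:ℝ), (α - 1) / Real.Gamma α * (1 - s) ^ (α - 1) =
      (α - 1) / Real.Gamma α * (I + t * J) := by
    intro t ht
    have hi : IntervalIntegrable (fun s : ℝ => (1 - s / t) ^ (α - 2)) volume 0 t := by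
      have := (intervalIntegrable_one_sub_rpow hβ).comp_mul_right (c := t⁻¹)
      simpa [ht.1.ne', div_eq_mul_inv, show α - 1 - 1 = α - 2 by ring] using this
    have hs : ∫ s in (0 : ℝ)..t, (1 - s / t) ^ (α - 2) = t * J := by
      rw [intervalIntegral.integral_comp_div (fun x : ℝ => (1 - x) ^ (α - 2)) ht.1.ne',
        zero_div, div_self ht.1.ne', smul_eq_mul, hJ, show α - 1 - 1 = α - 2 by ring]
    rw [intervalIntegral.integral_const_mul, intervalIntegral.integral_const_mul,
      intervalIntegral.integral_add (hc1 0 t) hi, hs, hI,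
      ← intervalIntegral.integral_add_adjacent_intervals (hc1 0 t)
        (hc1 t 1)]
    ring
  refine ⟨fun t ht => ?_, fun t => (α - 1) / Real.Gamma α * (A - t * W t),
    by fun_prop, fun t ht => ?_⟩
  · rw [hrhs t ht]
    have hk : 0 ≤ (α - 1) / Real.Gamma α := (div_pos hβ hΓ).le
    by_cases hd : DifferentiableAt ℝ u t
    · have hd1 : HasDerivWithinAt u (deriv u t) (Icc 0 1) t := hd.hasDerivAt.hasDerivWithinAt
      have hd2 := ((hUd t ht.1).hasDerivWithinAt (s := Icc 0 1)).congr huU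
        (huU (Ioc_subset_Icc_self ht))
      rw [(uniqueDiffOn_Icc zero_lt_one t (Ioc_subset_Icc_self ht)).eq_deriv _ hd1 hd2,
        hUv t ht.1, abs_mul, abs_of_nonneg hk, mul_left_comm M]
      refine mul_le_mul_of_nonneg_left ?_ hk
      calc |A - t * W t| ≤ |A| + |t * W t| := abs_sub _ _
        _ = |A| + t * |W t| := by rw [abs_mul, abs_of_pos ht.1]
        _ ≤ M * I + t * (M * J) :=
          add_le_add hAb (mul_le_mul_of_nonneg_left (hWb t) ht.1.le)
        _ = M * (I + t * J) := by ring
    · rw [deriv_zero_of_not_differentiableAt hd, mul_zero, abs_zero]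
      have := ht.1.le
      positivity
  · have hd := (hUd t ht.1).congr_of_eventuallyEq
      (Filter.eventuallyEq_of_mem (Icc_mem_nhds ht.1 ht.2) huU)
    rw [hd.deriv, hUv t ht.1]
end
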